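/- Let Ω = 𝕋 × (0,∞). Suppose ω, b : [0,T] × Ω → ℝ are smooth with ∂_z ω(t,·,0) = 0, decay at z = ∞, and ω satisfies ∂_t ω + U ∂_x ω + v U'' - κ ∂²_z ω = κ ∂_x ∂_z b, where v = -∫₀^z ∂_x u, ω = ∂_z u, ∂_x u + ∂²_z b = 0, u = b = 0 at z=0, and z U'' ∈ L^∞. Then (1/2)(d/dt)‖ω‖²_{L²} + (κ/2)(‖∂_z ω‖²_{L²} + ‖∂_x u‖²_{L²}) ≤ (2/κ)‖z U''‖²_{L^∞} ‖ω‖²_{L²}. -/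

import Mathlib

open Real Filter Topology MeasureTheory Set intervalIntegral

/-- The domain `Ω = 𝕋 × (0,∞)`, modeled as `(0,1] × (0,∞)` with period-1 functions. -/
noncomputable def μΩ : Measure (ℝ × ℝ) :=
  (volume.restrict (Ioc (0:ℝ) 1)).prod (volume.restrict (Ioi (0:ℝ)))

noncomputable def dX (f : ℝ → ℝ → ℝ) (x z : ℝ) : ℝ := deriv (fun x' => f x' z) x
noncomputable def dZ (f : ℝ → ℝ → ℝ) (x z : ℝ) : ℝ := deriv (fun z' => f x z') z

/-- squared L² norm on Ω -/
noncomputable def sqL2 (f : ℝ → ℝ → ℝ) : ℝ := ∫ p, (f p.1 p.2)^2 ∂μΩ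


/-- Step 1: integrated inequality on an interval where the dissipation is integrable in time. -/
lemma core_step1 {s t : ℝ} (hst : s ≤ t) {E D β : ℝ → ℝ} {e e' d r : ℕ → ℝ → ℝ} {a c K K' : ℝ}
    (ha : 0 ≤ a) (hc : 0 < c)
    (hEc : ContinuousOn E (Icc s t))
    (hec : ∀ n, Continuous (e n)) (hdc : ∀ n, Continuous (d n)) (hrc : ∀ n, Continuous (r n))
    (hβ : ContinuousOn β (Icc s t))
    (hder : ∀ n, ∀ τ ∈ Icc s t, HasDerivAt (e n) (e' n τ) τ)
    (hineq : ∀ n, ∀ τ ∈ Icc s t, e' n τ ≤ - c * d n τ + a * e n τ + r n τ)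
    (hd0 : ∀ n τ, 0 ≤ d n τ)
    (hdm : ∀ τ ∈ Icc s t, Monotone (fun n => d n τ))
    (hdD : ∀ τ ∈ Icc s t, Tendsto (fun n => d n τ) atTop (𝓝 (D τ)))
    (hrb : ∀ n, ∀ τ ∈ Icc s t, |r n τ| ≤ K * D τ + β τ)
    (hr0 : ∀ τ ∈ Icc s t, Tendsto (fun n => r n τ) atTop (𝓝 0))
    (heE : ∀ τ ∈ Icc s t, Tendsto (fun n => e n τ) atTop (𝓝 (E τ)))
    (hele : ∀ n, ∀ τ ∈ Icc s t, e n τ ≤ E τ)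
    (hK' : ∀ n, ∫ τ in s..t, d n τ ≤ K') (m : ℕ) :
    E t - E s + c * ∫ τ in s..t, d m τ ≤ a * ∫ τ in s..t, E τ := by
  have hEi : IntervalIntegrable E volume s t := hEc.intervalIntegrable_of_Icc hst
  -- per-n inequality
  have h1 : ∀ n, m ≤ n → e n t - e n s + c * (∫ τ in s..t, d m τ)
      ≤ a * (∫ τ in s..t, E τ) + ∫ τ in s..t, r n τ := by
    intro n hn
    have hfc : Continuous (fun τ => - c * d n τ + a * e n τ + r n τ) := by
      have := hdc n; have := hec n; have := hrc n; fun_prop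
    have hle : e n t - e n s ≤ ∫ τ in s..t, (- c * d n τ + a * e n τ + r n τ) := by
      apply sub_le_integral_of_hasDeriv_right_of_le hst (hec n).continuousOn
        (fun τ hτ => (hder n τ (Ioo_subset_Icc_self hτ)).hasDerivWithinAt)
        (hfc.integrableOn_Icc) (fun τ hτ => hineq n τ (Ioo_subset_Icc_self hτ))
    have i1 := (hdc n).intervalIntegrable (μ := volume) s t
    have i2 := (hec n).intervalIntegrable (μ := volume) s t
    have i3 := (hrc n).intervalIntegrable (μ := volume) s t
    rw [intervalIntegral.integral_add ((i1.const_mul _).add (i2.const_mul _)) i3,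
      intervalIntegral.integral_add (i1.const_mul _) (i2.const_mul _),
      intervalIntegral.integral_const_mul, intervalIntegral.integral_const_mul] at hle
    have h2 : ∫ τ in s..t, d m τ ≤ ∫ τ in s..t, d n τ :=
      intervalIntegral.integral_mono_on hst ((hdc m).intervalIntegrable _ _) i1
        (fun τ hτ => hdm τ hτ hn)
    have h3 : ∫ τ in s..t, e n τ ≤ ∫ τ in s..t, E τ :=
      intervalIntegral.integral_mono_on hst i2 hEi (fun τ hτ => hele n τ hτ)
    have h4 := mul_le_mul_of_nonneg_left h2 hc.le
    have h5 := mul_le_mul_of_nonneg_left h3 ha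
    linarith
  -- D integrable
  have hDi : IntegrableOn D (Ioc s t) := by
    have hb : liminf (fun n => ∫⁻ τ in Ioc s t, ‖d n τ‖ₑ) atTop ≤ ENNReal.ofReal K' := by
      apply liminf_le_of_frequently_le'
      apply Frequently.of_forall
      intro n
      have hI : IntegrableOn (d n) (Ioc s t) := ((hdc n).intervalIntegrable s t).1
      have : ∫⁻ τ in Ioc s t, ‖d n τ‖ₑ = ENNReal.ofReal (∫ τ in Ioc s t, d n τ) := by
        rw [ofReal_integral_eq_lintegral_ofReal hI (ae_of_all _ (hd0 n))]
        refine lintegral_congr fun τ => ?_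
        rw [Real.enorm_eq_ofReal (hd0 n τ)]
      rw [this]
      apply ENNReal.ofReal_le_ofReal
      have := hK' n
      rwa [intervalIntegral.integral_of_le hst] at this
    have hlim : ∀ᵐ τ ∂(volume.restrict (Ioc s t)), Tendsto (fun n => d n τ) atTop (𝓝 (D τ)) := by
      filter_upwards [ae_restrict_mem measurableSet_Ioc] with τ hτ
      exact hdD τ (Ioc_subset_Icc_self hτ)
    refine integrable_of_tendsto hlim (fun n => (hdc n).aestronglyMeasurable) ?_
    exact (hb.trans_lt ENNReal.ofReal_lt_top).ne
  have hr : Tendsto (fun n => ∫ τ in s..t, r n τ) atTop (𝓝 0) := by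
    have := intervalIntegral.tendsto_integral_filter_of_dominated_convergence (μ := volume)
      (a := s) (b := t) (F := r) (f := fun _ => (0:ℝ)) (l := atTop) (fun τ => K * D τ + β τ)
      (Eventually.of_forall fun n => (hrc n).aestronglyMeasurable)
      (Eventually.of_forall fun n => ae_of_all _ fun τ hτ => by
        rw [uIoc_of_le hst] at hτ
        exact hrb n τ (Ioc_subset_Icc_self hτ))
      (by
        have : IntervalIntegrable D volume s t := by
          rwa [intervalIntegrable_iff_integrableOn_Ioc_of_le hst]
        exact (this.const_mul K).add (hβ.intervalIntegrable_of_Icc hst))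
      (ae_of_all _ fun τ hτ => by
        rw [uIoc_of_le hst] at hτ
        exact hr0 τ (Ioc_subset_Icc_self hτ))
    simpa using this
  have hL : Tendsto (fun n => e n t - e n s + c * (∫ τ in s..t, d m τ)) atTop
      (𝓝 (E t - E s + c * (∫ τ in s..t, d m τ))) :=
    (((heE t ⟨hst, le_rfl⟩).sub (heE s ⟨le_rfl, hst⟩))).add_const _
  have hR : Tendsto (fun n => a * (∫ τ in s..t, E τ) + ∫ τ in s..t, r n τ) atTop
      (𝓝 (a * (∫ τ in s..t, E τ) + 0)) := hr.const_add _
  rw [add_zero] at hR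
  exact le_of_tendsto_of_tendsto hL hR ((eventually_ge_atTop m).mono h1)

/-- Step 2: pointwise inequality at good times. -/
lemma core_step2 {p q : ℝ} {E : ℝ → ℝ} {g : ℝ → ℝ} {a c : ℝ}
    (hE : DifferentiableOn ℝ E (Ioo p q)) (hg : Continuous g)
    (h : ∀ s ∈ Ioo p q, ∀ t ∈ Ioo p q, s ≤ t →
      E t - E s + c * ∫ τ in s..t, g τ ≤ a * ∫ τ in s..t, E τ) :
    ∀ τ ∈ Ioo p q, deriv E τ + c * g τ ≤ a * E τ := by
  intro τ hτ
  have hEτ : HasDerivAt E (deriv E τ) τ := (hE.differentiableAt (Ioo_mem_nhds hτ.1 hτ.2)).hasDerivAt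
  have hg' : HasDerivAt (fun t => ∫ x in τ..t, g x) (g τ) τ :=
    intervalIntegral.integral_hasDerivAt_right (hg.intervalIntegrable _ _)
      (hg.stronglyMeasurableAtFilter _ _) hg.continuousAt
  have hE' : HasDerivAt (fun t => ∫ x in τ..t, E x) (E τ) τ :=
    intervalIntegral.integral_hasDerivAt_right (by simp)
      (hE.continuousOn.stronglyMeasurableAtFilter isOpen_Ioo τ hτ) hEτ.continuousAt
  have hΦ : HasDerivAt (fun t => E t + c * (∫ x in τ..t, g x) - a * ∫ x in τ..t, E x)
      (deriv E τ + c * g τ - a * E τ) τ := (hEτ.add (hg'.const_mul c)).sub (hE'.const_mul a)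
  have hle : deriv E τ + c * g τ - a * E τ ≤ 0 := by
    refine le_of_tendsto ((hasDerivAt_iff_tendsto_slope.1 hΦ).mono_left
      (nhdsWithin_mono _ (fun x (hx : x ∈ Ioi τ) => (ne_of_gt hx : x ≠ τ)))) ?_
    filter_upwards [Ioo_mem_nhdsGT hτ.2] with t ht
    have := h τ hτ t ⟨hτ.1.trans ht.1, ht.2⟩ ht.1.le
    rw [slope_def_field]
    apply div_nonpos_of_nonpos_of_nonneg _ (by linarith [ht.1])
    simp
    linarith
  linarith

theorem core {T : ℝ} {E D β : ℝ → ℝ} {e e' d r : ℕ → ℝ → ℝ} {a c K : ℝ}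
    (ha : 0 ≤ a) (hc : 0 < c)
    (hE : DifferentiableOn ℝ E (Ioo 0 T))
    (hec : ∀ n, Continuous (e n)) (hdc : ∀ n, Continuous (d n)) (hrc : ∀ n, Continuous (r n))
    (hβ : ContinuousOn β (Ioo 0 T))
    (hder : ∀ n, ∀ τ ∈ Ioo 0 T, HasDerivAt (e n) (e' n τ) τ)
    (hineq : ∀ n, ∀ τ ∈ Ioo 0 T, e' n τ ≤ - c * d n τ + a * e n τ + r n τ)
    (hd0 : ∀ n τ, 0 ≤ d n τ)
    (hdm : ∀ τ ∈ Ioo 0 T, Monotone (fun n => d n τ))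
    (hdD : ∀ τ ∈ Ioo 0 T, Tendsto (fun n => d n τ) atTop (𝓝 (D τ)))
    (hrb : ∀ n, ∀ τ ∈ Ioo 0 T, |r n τ| ≤ K * D τ + β τ)
    (hr0 : ∀ τ ∈ Ioo 0 T, Tendsto (fun n => r n τ) atTop (𝓝 0))
    (heE : ∀ τ ∈ Ioo 0 T, Tendsto (fun n => e n τ) atTop (𝓝 (E τ)))
    (hele : ∀ n, ∀ τ ∈ Ioo 0 T, e n τ ≤ E τ) :
    ∀ τ ∈ Ioo 0 T, deriv E τ + c * D τ ≤ a * E τ := by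
  have hEc := hE.continuousOn
  -- good set
  set G : Set ℝ := {τ | ∃ p q, p < τ ∧ τ < q ∧ 0 < p ∧ q < T ∧
    ∃ K', ∀ n, ∫ x in p..q, d n x ≤ K'} with hG
  have hGo : IsOpen G := by
    rw [isOpen_iff_mem_nhds]
    rintro τ ⟨p, q, h1, h2, h3, h4, h5⟩
    filter_upwards [Ioo_mem_nhds h1 h2] with x hx
    exact ⟨p, q, hx.1, hx.2, h3, h4, h5⟩
  have hgood : ∀ τ ∈ G, ∀ m, deriv E τ + c * d m τ ≤ a * E τ := by
    rintro τ ⟨p, q, h1, h2, h3, h4, K', hK'⟩ m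
    have hsub : ∀ x ∈ Icc p q, x ∈ Ioo 0 T := fun x hx => ⟨h3.trans_le hx.1, hx.2.trans_lt h4⟩
    refine core_step2 (p := p) (q := q)
      (hE.mono fun x hx => hsub x (Ioo_subset_Icc_self hx)) (hdc m) ?_ τ ⟨h1, h2⟩
    intro s hs t ht hst
    have hsub' : ∀ x ∈ Icc s t, x ∈ Ioo 0 T := fun x hx =>
      hsub x ⟨hs.1.le.trans hx.1, hx.2.trans ht.2.le⟩
    refine core_step1 (K' := K') (β := β) (D := D) (K := K) (r := r) (e := e) (e' := e') hst ha hc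
      (hEc.mono hsub') hec hdc hrc (hβ.mono hsub')
      (fun n x hx => hder n x (hsub' x hx)) (fun n x hx => hineq n x (hsub' x hx)) hd0
      (fun x hx => hdm x (hsub' x hx)) (fun x hx => hdD x (hsub' x hx))
      (fun n x hx => hrb n x (hsub' x hx)) (fun x hx => hr0 x (hsub' x hx))
      (fun x hx => heE x (hsub' x hx)) (fun n x hx => hele n x (hsub' x hx)) ?_ m
    intro n
    refine le_trans ?_ (hK' n)
    exact intervalIntegral.integral_mono_interval hs.1.le hst ht.2.le
      (ae_of_all _ (hd0 n)) ((hdc n).intervalIntegrable _ _)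
  suffices hall : ∀ τ ∈ Ioo 0 T, τ ∈ G by
    intro τ hτ
    refine le_of_tendsto (((hdD τ hτ).const_mul c).const_add _)
      (Eventually.of_forall fun m => hgood τ (hall τ hτ) m)
  by_contra hne
  push Not at hne
  obtain ⟨τ₁, hτ₁, hτ₁G⟩ := hne
  set B : Set ℝ := Ioo 0 T ∩ Gᶜ with hB
  have hBl : IsLocallyClosed B := isOpen_Ioo.isLocallyClosed.inter hGo.isClosed_compl.isLocallyClosed
  have : LocallyCompactSpace B := hBl.locallyCompactSpace
  have : Nonempty B := ⟨⟨τ₁, hτ₁, hτ₁G⟩⟩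
  -- forward difference quotients
  let h : ℕ → ℝ → ℝ := fun n τ => (T - τ) / (n + 2)
  have hhpos : ∀ n, ∀ τ ∈ Ioo 0 T, 0 < h n τ := fun n τ hτ =>
    div_pos (by linarith [hτ.2]) (by positivity)
  have hhin : ∀ n, ∀ τ ∈ Ioo 0 T, τ + h n τ ∈ Ioo 0 T := by
    intro n τ hτ
    refine ⟨by linarith [hτ.1, hhpos n τ hτ], ?_⟩
    have : h n τ < T - τ := by
      apply div_lt_self (by linarith [hτ.2])
      have : (0:ℝ) ≤ n := Nat.cast_nonneg n
      linarith
    linarith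
  let Q : ℕ → ℝ → ℝ := fun n τ => (E (τ + h n τ) - E τ) / h n τ
  have hhc : ∀ n, Continuous (h n) := fun n => by
    dsimp only [h]; fun_prop
  have hQc : ∀ n, ContinuousOn (Q n) (Ioo 0 T) := by
    intro n
    refine ContinuousOn.div (ContinuousOn.sub ?_ hEc) (hhc n).continuousOn
      (fun τ hτ => (hhpos n τ hτ).ne')
    exact hEc.comp (continuous_id.add (hhc n)).continuousOn (fun τ hτ => hhin n τ hτ)
  have hQlim : ∀ τ ∈ Ioo 0 T, Tendsto (fun n => Q n τ) atTop (𝓝 (deriv E τ)) := by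
    intro τ hτ
    have hEτ : HasDerivAt E (deriv E τ) τ :=
      (hE.differentiableAt (Ioo_mem_nhds hτ.1 hτ.2)).hasDerivAt
    have h0 : Tendsto (fun n => h n τ) atTop (𝓝 0) := by
      apply Tendsto.div_atTop tendsto_const_nhds
      exact tendsto_atTop_add_const_right _ _ tendsto_natCast_atTop_atTop
    have h1 : Tendsto (fun n => τ + h n τ) atTop (𝓝[≠] τ) := by
      rw [tendsto_nhdsWithin_iff]
      refine ⟨by simpa using h0.const_add τ, Eventually.of_forall fun n => ?_⟩
      have := hhpos n τ hτ
      simp [this.ne']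
    have := (hasDerivAt_iff_tendsto_slope.1 hEτ).comp h1
    refine this.congr fun n => ?_
    simp [Q, slope_def_field]
  let A : ℕ → Set B := fun N => {τ | (∀ n, d n τ ≤ N) ∧ ∀ n, Q n τ ≤ N}
  have hAc : ∀ N, IsClosed (A N) := by
    intro N
    have e1 : A N = (⋂ n, {τ : B | d n τ ≤ N}) ∩ ⋂ n, {τ : B | Q n τ ≤ N} := by
      ext τ; simp [A]
    rw [e1]
    refine (isClosed_iInter fun n => ?_).inter (isClosed_iInter fun n => ?_)
    · exact isClosed_le ((hdc n).comp continuous_subtype_val) continuous_const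
    · refine isClosed_le ?_ continuous_const
      exact (hQc n).comp_continuous continuous_subtype_val (fun τ => τ.2.1)
  have hAU : ⋃ N, A N = univ := by
    rw [eq_univ_iff_forall]
    intro τ
    obtain ⟨C1, hC1⟩ := (hQlim τ τ.2.1).bddAbove_range
    obtain ⟨N, hN⟩ := exists_nat_ge (max C1 (D τ))
    rw [mem_iUnion]
    refine ⟨N, fun n => ?_, fun n => ?_⟩
    · exact ((hdm τ τ.2.1).ge_of_tendsto (hdD τ τ.2.1) n).trans ((le_max_right _ _).trans hN)
    · exact (hC1 ⟨n, rfl⟩).trans ((le_max_left _ _).trans hN)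
  obtain ⟨N, ⟨τ₀, hτ₀⟩⟩ := nonempty_interior_of_iUnion_of_closed hAc hAU
  rw [mem_interior_iff_mem_nhds, nhds_subtype_eq_comap, mem_comap] at hτ₀
  obtain ⟨V, hV, hVA⟩ := hτ₀
  have hV' : V ∩ Ioo 0 T ∈ 𝓝 (τ₀:ℝ) := inter_mem hV (Ioo_mem_nhds τ₀.2.1.1 τ₀.2.1.2)
  obtain ⟨ε, hε, hball⟩ := Metric.nhds_basis_closedBall.mem_iff.1 hV'
  rw [Real.closedBall_eq_Icc] at hball
  set p := (τ₀:ℝ) - ε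
  set q := (τ₀:ℝ) + ε
  have hpq : p ≤ q := by simp only [p, q]; linarith
  have hsub : Icc p q ⊆ Ioo 0 T := fun x hx => (hball hx).2
  obtain ⟨S, hS⟩ := (isCompact_Icc (a := p) (b := q)).bddAbove_image (hEc.mono hsub)
  apply τ₀.2.2
  refine ⟨p, q, by simp only [p]; linarith, by simp only [q]; linarith, (hsub ⟨le_rfl, hpq⟩).1,
    (hsub ⟨hpq, le_rfl⟩).2, ((max (N + c * N) (a * S)) * (q - p) - (E q - E p)) / c, fun m => ?_⟩
  have hbd : ∀ τ ∈ Icc p q, deriv E τ + c * d m τ ≤ max (N + c * N) (a * S) := by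
    intro τ hτ
    by_cases hg : τ ∈ G
    · refine ((hgood τ hg m).trans ?_).trans (le_max_right _ _)
      exact mul_le_mul_of_nonneg_left (hS ⟨τ, hτ, rfl⟩) ha
    · have hmem : (⟨τ, hsub hτ, hg⟩ : B) ∈ A N := hVA (hball hτ).1
      refine le_trans ?_ (le_max_left _ _)
      have h1 : deriv E τ ≤ N :=
        le_of_tendsto (hQlim τ (hsub hτ)) (Eventually.of_forall fun n => hmem.2 n)
      have h2 := mul_le_mul_of_nonneg_left (hmem.1 m) hc.le
      exact add_le_add h1 h2
  have hmv := sub_le_integral_of_hasDeriv_right_of_le (a := p) (b := q) (g := E)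
    (g' := fun τ => deriv E τ) (φ := fun τ => max (N + c * N) (a * S) - c * d m τ) hpq
    (hEc.mono hsub)
    (fun τ hτ => by
      have := hsub (Ioo_subset_Icc_self hτ)
      exact (hE.differentiableAt (Ioo_mem_nhds this.1 this.2)).hasDerivAt.hasDerivWithinAt)
    (by have := hdc m
        exact Continuous.integrableOn_Icc (by fun_prop))
    (fun τ hτ => by linarith [hbd τ (Ioo_subset_Icc_self hτ)])
  rw [intervalIntegral.integral_sub (by simp) (((hdc m).intervalIntegrable _ _).const_mul c)] at hmv
  simp only [intervalIntegral.integral_const, smul_eq_mul, intervalIntegral.integral_const_mul] at hmv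
  rw [le_div_iff₀ hc]
  linarith
/-- joint smoothness in `(t,x,z)` -/
def Sm (f : ℝ → ℝ → ℝ → ℝ) : Prop :=
  ContDiff ℝ (⊤ : ℕ∞) (fun p : ℝ × ℝ × ℝ => f p.1 p.2.1 p.2.2)

/-- smoothness in `(x,z)` -/
def Sm2 (f : ℝ → ℝ → ℝ) : Prop :=
  ContDiff ℝ (⊤ : ℕ∞) (fun p : ℝ × ℝ => f p.1 p.2)

lemma Sm.slice {f : ℝ → ℝ → ℝ → ℝ} (hf : Sm f) (t : ℝ) : Sm2 (f t) := by
  unfold Sm2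
  exact ContDiff.comp hf (g := fun p : ℝ × ℝ × ℝ => f p.1 p.2.1 p.2.2)
    (f := fun p : ℝ × ℝ => (t, p.1, p.2)) (by fun_prop)

lemma Sm.hasDerivAt_x {f : ℝ → ℝ → ℝ → ℝ} (hf : Sm f) (t x z : ℝ) :
    HasDerivAt (fun x' => f t x' z)
      (fderiv ℝ (fun p : ℝ × ℝ × ℝ => f p.1 p.2.1 p.2.2) (t, x, z) (0, 1, 0)) x := by
  have h1 : HasFDerivAt (fun p : ℝ × ℝ × ℝ => f p.1 p.2.1 p.2.2) _ (t, x, z) :=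
    (hf.differentiable (by simp) (t, x, z)).hasFDerivAt
  have h2 : HasDerivAt (fun x' : ℝ => ((t, x', z) : ℝ × ℝ × ℝ)) (0, 1, 0) x :=
    (hasDerivAt_const x t).prodMk ((hasDerivAt_id x).prodMk (hasDerivAt_const x z))
  exact h1.comp_hasDerivAt x h2

lemma Sm.hasDerivAt_z {f : ℝ → ℝ → ℝ → ℝ} (hf : Sm f) (t x z : ℝ) :
    HasDerivAt (fun z' => f t x z')
      (fderiv ℝ (fun p : ℝ × ℝ × ℝ => f p.1 p.2.1 p.2.2) (t, x, z) (0, 0, 1)) z := by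
  have h1 : HasFDerivAt (fun p : ℝ × ℝ × ℝ => f p.1 p.2.1 p.2.2) _ (t, x, z) :=
    (hf.differentiable (by simp) (t, x, z)).hasFDerivAt
  have h2 : HasDerivAt (fun z' : ℝ => ((t, x, z') : ℝ × ℝ × ℝ)) (0, 0, 1) z :=
    (hasDerivAt_const z t).prodMk ((hasDerivAt_const z x).prodMk (hasDerivAt_id z))
  exact h1.comp_hasDerivAt z h2

lemma Sm.hasDerivAt_t {f : ℝ → ℝ → ℝ → ℝ} (hf : Sm f) (t x z : ℝ) :
    HasDerivAt (fun t' => f t' x z)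
      (fderiv ℝ (fun p : ℝ × ℝ × ℝ => f p.1 p.2.1 p.2.2) (t, x, z) (1, 0, 0)) t := by
  have h1 : HasFDerivAt (fun p : ℝ × ℝ × ℝ => f p.1 p.2.1 p.2.2) _ (t, x, z) :=
    (hf.differentiable (by simp) (t, x, z)).hasFDerivAt
  have h2 : HasDerivAt (fun t' : ℝ => ((t', x, z) : ℝ × ℝ × ℝ)) (1, 0, 0) t :=
    (hasDerivAt_id t).prodMk ((hasDerivAt_const t x).prodMk (hasDerivAt_const t z))
  exact h1.comp_hasDerivAt t h2

lemma Sm.fd {f : ℝ → ℝ → ℝ → ℝ} (hf : Sm f) (e : ℝ × ℝ × ℝ) :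
    ContDiff ℝ (⊤ : ℕ∞) (fun p => fderiv ℝ (fun p : ℝ × ℝ × ℝ => f p.1 p.2.1 p.2.2) p e) := by
  have : ContDiff ℝ (⊤ : ℕ∞) (fderiv ℝ (fun p : ℝ × ℝ × ℝ => f p.1 p.2.1 p.2.2)) :=
    hf.fderiv_right (by norm_cast)
  exact this.clm_apply contDiff_const

lemma Sm.dX {f : ℝ → ℝ → ℝ → ℝ} (hf : Sm f) : Sm (fun t => dX (f t)) := by
  have h := hf.fd (0, 1, 0)
  unfold Sm
  convert h using 2 with p
  exact (hf.hasDerivAt_x p.1 p.2.1 p.2.2).deriv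

lemma Sm.dZ {f : ℝ → ℝ → ℝ → ℝ} (hf : Sm f) : Sm (fun t => dZ (f t)) := by
  have h := hf.fd (0, 0, 1)
  unfold Sm
  convert h using 2 with p
  exact (hf.hasDerivAt_z p.1 p.2.1 p.2.2).deriv

lemma Sm.dT {f : ℝ → ℝ → ℝ → ℝ} (hf : Sm f) :
    Sm (fun t x z => deriv (fun s => f s x z) t) := by
  have h := hf.fd (1, 0, 0)
  unfold Sm
  convert h using 2 with p
  exact (hf.hasDerivAt_t p.1 p.2.1 p.2.2).deriv

lemma Sm2.lift {g : ℝ → ℝ → ℝ} (hg : Sm2 g) : Sm (fun _ => g) := by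
  exact ContDiff.comp hg (g := fun p : ℝ × ℝ => g p.1 p.2)
    (f := fun p : ℝ × ℝ × ℝ => (p.2.1, p.2.2)) (by fun_prop)

lemma Sm2.dX {g : ℝ → ℝ → ℝ} (hg : Sm2 g) : Sm2 (dX g) := hg.lift.dX.slice 0
lemma Sm2.dZ {g : ℝ → ℝ → ℝ} (hg : Sm2 g) : Sm2 (dZ g) := hg.lift.dZ.slice 0

lemma Sm2.hX {g : ℝ → ℝ → ℝ} (hg : Sm2 g) (x z : ℝ) :
    HasDerivAt (fun x' => g x' z) (_root_.dX g x z) x :=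
  (hg.lift.hasDerivAt_x 0 x z).differentiableAt.hasDerivAt
lemma Sm2.hZ {g : ℝ → ℝ → ℝ} (hg : Sm2 g) (x z : ℝ) :
    HasDerivAt (fun z' => g x z') (_root_.dZ g x z) z :=
  (hg.lift.hasDerivAt_z 0 x z).differentiableAt.hasDerivAt

lemma Sm2.cont {g : ℝ → ℝ → ℝ} (hg : Sm2 g) : Continuous (fun p : ℝ × ℝ => g p.1 p.2) :=
  ContDiff.continuous hg
lemma Sm.cont {g : ℝ → ℝ → ℝ → ℝ} (hg : Sm g) :
    Continuous (fun p : ℝ × ℝ × ℝ => g p.1 p.2.1 p.2.2) :=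
  ContDiff.continuous hg

/-- mixed partials commute -/
lemma Sm2.comm {g : ℝ → ℝ → ℝ} (hg : Sm2 g) (x z : ℝ) :
    _root_.dZ (_root_.dX g) x z = _root_.dX (_root_.dZ g) x z := by
  set F : ℝ × ℝ → ℝ := fun p => g p.1 p.2 with hF
  have hF' : ContDiff ℝ (⊤ : ℕ∞) F := hg
  have hfx : ∀ a c, _root_.dX g a c = fderiv ℝ F (a, c) (1, 0) := by
    intro a c
    have h1 : HasFDerivAt F _ (a, c) := (hF'.differentiable (by simp) (a, c)).hasFDerivAt
    have h2 : HasDerivAt (fun x' : ℝ => ((x', c) : ℝ × ℝ)) (1, 0) a :=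
      (hasDerivAt_id a).prodMk (hasDerivAt_const a c)
    exact (h1.comp_hasDerivAt a h2).deriv
  have hfz : ∀ a c, _root_.dZ g a c = fderiv ℝ F (a, c) (0, 1) := by
    intro a c
    have h1 : HasFDerivAt F _ (a, c) := (hF'.differentiable (by simp) (a, c)).hasFDerivAt
    have h2 : HasDerivAt (fun x' : ℝ => ((a, x') : ℝ × ℝ)) (0, 1) c :=
      (hasDerivAt_const c a).prodMk (hasDerivAt_id c)
    exact (h1.comp_hasDerivAt c h2).deriv
  have hd : HasFDerivAt (fderiv ℝ F) (fderiv ℝ (fderiv ℝ F) (x, z)) (x, z) :=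
    (((hF'.fderiv_right (m := (⊤ : ℕ∞)) (by norm_cast)).differentiable (by simp)) (x, z)).hasFDerivAt
  have e1 : _root_.dZ (_root_.dX g) x z = fderiv ℝ (fderiv ℝ F) (x, z) (0, 1) (1, 0) := by
    have h2 : HasDerivAt (fun x' : ℝ => ((x, x') : ℝ × ℝ)) (0, 1) z :=
      (hasDerivAt_const z x).prodMk (hasDerivAt_id z)
    have h3 := (ContinuousLinearMap.apply ℝ ℝ ((1, 0) : ℝ × ℝ)).hasFDerivAt.comp_hasDerivAt z
      (hd.comp_hasDerivAt z h2)
    have h4 : HasDerivAt (fun z' => _root_.dX g x z')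
        (fderiv ℝ (fderiv ℝ F) (x, z) (0, 1) (1, 0)) z := by
      simp_rw [hfx]
      exact h3
    exact h4.deriv
  have e2 : _root_.dX (_root_.dZ g) x z = fderiv ℝ (fderiv ℝ F) (x, z) (1, 0) (0, 1) := by
    have h2 : HasDerivAt (fun x' : ℝ => ((x', z) : ℝ × ℝ)) (1, 0) x :=
      (hasDerivAt_id x).prodMk (hasDerivAt_const x z)
    have h3 := (ContinuousLinearMap.apply ℝ ℝ ((0, 1) : ℝ × ℝ)).hasFDerivAt.comp_hasDerivAt x
      (hd.comp_hasDerivAt x h2)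
    have h4 : HasDerivAt (fun x' => _root_.dZ g x' z)
        (fderiv ℝ (fderiv ℝ F) (x, z) (1, 0) (0, 1)) x := by
      simp_rw [hfz]
      exact h3
    exact h4.deriv
  rw [e1, e2]
  have := (hF'.contDiffAt (x := (x, z))).isSymmSndFDerivAt (by
    rw [minSmoothness_of_isRCLikeNormedField]
    exact WithTop.coe_le_coe.2 (le_top : (2:ℕ∞) ≤ ⊤))
  exact this.eq _ _

/-- The box. -/
def bx (a R : ℝ) : Set (ℝ × ℝ) := Icc (0:ℝ) 1 ×ˢ Icc a R

lemma bx_compact (a R : ℝ) : IsCompact (bx a R) := isCompact_Icc.prod isCompact_Icc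
lemma bx_meas (a R : ℝ) : MeasurableSet (bx a R) := measurableSet_Icc.prod measurableSet_Icc

lemma divX {a R : ℝ} (P Px : ℝ → ℝ → ℝ)
    (hc : Continuous (fun p : ℝ × ℝ => Px p.1 p.2))
    (hd : ∀ x z, HasDerivAt (fun x' => P x' z) (Px x z) x)
    (hper : ∀ z, P 1 z = P 0 z) : ∫ p in bx a R, Px p.1 p.2 = 0 := by
  have hi : IntegrableOn (fun p : ℝ × ℝ => Px p.1 p.2) (bx a R) (volume.prod volume) :=
    hc.continuousOn.integrableOn_compact (bx_compact a R)
  have e : ∫ p in bx a R, Px p.1 p.2 = ∫ z in Icc a R, ∫ x in Icc (0:ℝ) 1, Px x z := by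
    unfold bx
    rw [Measure.volume_eq_prod, ← Measure.prod_restrict, integral_prod_symm]
    rw [Measure.prod_restrict]; exact hi
  rw [e]
  have : ∀ z, ∫ x in Icc (0:ℝ) 1, Px x z = 0 := by
    intro z
    rw [integral_Icc_eq_integral_Ioc, ← intervalIntegral.integral_of_le zero_le_one,
      intervalIntegral.integral_eq_sub_of_hasDerivAt (fun x _ => hd x z), hper, sub_self]
    apply Continuous.intervalIntegrable
    exact hc.comp (by fun_prop : Continuous fun x : ℝ => (x, z))
  simp [this]

lemma divZ {a R : ℝ} (haR : a ≤ R) (Q Qz : ℝ → ℝ → ℝ)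
    (hc : ContinuousOn (fun p : ℝ × ℝ => Qz p.1 p.2) (bx a R))
    (hd : ∀ x, ∀ z ∈ Icc a R, HasDerivAt (fun z' => Q x z') (Qz x z) z) :
    ∫ p in bx a R, Qz p.1 p.2 = ∫ x in Icc (0:ℝ) 1, (Q x R - Q x a) := by
  have hi : IntegrableOn (fun p : ℝ × ℝ => Qz p.1 p.2) (bx a R) (volume.prod volume) :=
    hc.integrableOn_compact (bx_compact a R)
  have e : ∫ p in bx a R, Qz p.1 p.2 = ∫ x in Icc (0:ℝ) 1, ∫ z in Icc a R, Qz x z := by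
    unfold bx
    rw [Measure.volume_eq_prod]
    exact setIntegral_prod _ hi
  rw [e]
  refine setIntegral_congr_fun measurableSet_Icc fun x hx => ?_
  rw [integral_Icc_eq_integral_Ioc, ← intervalIntegral.integral_of_le haR,
      intervalIntegral.integral_eq_sub_of_hasDerivAt
        (fun z hz => hd x z (by rwa [uIcc_of_le haR] at hz))]
  apply ContinuousOn.intervalIntegrable
  rw [uIcc_of_le haR]
  exact hc.comp (f := fun z : ℝ => (x, z)) (by fun_prop) (fun z hz => ⟨hx, hz⟩)

/-- continuity of parametric integrals over the box -/
lemma bx_cont {F : ℝ → ℝ × ℝ → ℝ} (hF : Continuous (fun q : ℝ × ℝ × ℝ => F q.1 q.2)) (a R : ℝ) :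
    Continuous (fun t => ∫ p in bx a R, F t p) :=
  continuous_parametric_integral_of_continuous (f := F) hF (bx_compact a R)

lemma bx_deriv {F F' : ℝ → ℝ × ℝ → ℝ} (hF : Continuous (fun q : ℝ × ℝ × ℝ => F q.1 q.2))
    (hF' : Continuous (fun q : ℝ × ℝ × ℝ => F' q.1 q.2))
    (hd : ∀ t p, HasDerivAt (fun s => F s p) (F' t p) t) (a R t : ℝ) :
    HasDerivAt (fun t => ∫ p in bx a R, F t p) (∫ p in bx a R, F' t p) t := by
  obtain ⟨C, hC⟩ := ((isCompact_closedBall t 1).prod (bx_compact a R)).exists_bound_of_continuousOn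
    hF'.continuousOn
  have hcs : ∀ s, Continuous (F s) := fun s => hF.comp (by fun_prop : Continuous fun p : ℝ × ℝ => (s, p))
  have hcs' : ∀ s, Continuous (F' s) :=
    fun s => hF'.comp (by fun_prop : Continuous fun p : ℝ × ℝ => (s, p))
  refine (hasDerivAt_integral_of_dominated_loc_of_deriv_le (bound := fun _ => C)
    (Metric.closedBall_mem_nhds t one_pos)
    (Eventually.of_forall fun s => (hcs s).aestronglyMeasurable)
    ((hcs t).continuousOn.integrableOn_compact (bx_compact a R))
    (hcs' t).aestronglyMeasurable ?_ ?_ (ae_of_all _ fun p s _ => hd s p)).2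
  · filter_upwards [ae_restrict_mem (bx_meas a R)] with p hp s hs
    exact hC (s, p) ⟨hs, hp⟩
  · exact integrableOn_const (bx_compact a R).measure_lt_top.ne

/-! ### cutoffs -/

lemma bx_restrict (R : ℝ) : (volume : Measure (ℝ × ℝ)).restrict (bx 0 R)
    = volume.restrict (Ioc (0:ℝ) 1 ×ˢ Ioc (0:ℝ) R) := by
  unfold bx
  rw [Measure.volume_eq_prod, ← Measure.prod_restrict, ← Measure.prod_restrict,
    Measure.restrict_congr_set Ioc_ae_eq_Icc, Measure.restrict_congr_set Ioc_ae_eq_Icc]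

lemma μΩ_eq : μΩ = volume.restrict (Ioc (0:ℝ) 1 ×ˢ Ioi (0:ℝ)) := by
  unfold μΩ
  rw [Measure.prod_restrict, Measure.volume_eq_prod]

/-- global version of the cutoff -/
noncomputable def cut (n : ℕ) (z : ℝ) : ℝ := (max 0 (1 - z / (n + 1)))^2

lemma cut_eq (n : ℕ) (g : ℝ × ℝ → ℝ) :
    ∫ p in bx 0 (n+1), (1 - p.2/(n+1))^2 * g p = ∫ p, cut n p.2 * g p ∂μΩ := by
  have hn : (0:ℝ) < n + 1 := by positivity
  rw [bx_restrict, μΩ_eq]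
  rw [setIntegral_eq_of_subset_of_forall_sdiff_eq_zero
    (s := Ioc (0:ℝ) 1 ×ˢ Ioc (0:ℝ) (n+1)) (t := Ioc (0:ℝ) 1 ×ˢ Ioi (0:ℝ))
    (measurableSet_Ioc.prod measurableSet_Ioi)]
  · refine setIntegral_congr_fun (measurableSet_Ioc.prod measurableSet_Ioc) fun p hp => ?_
    have : p.2 / (n+1) ≤ 1 := by rw [div_le_one hn]; exact hp.2.2
    simp only [cut]
    rw [max_eq_right (by linarith)]
  · exact prod_mono_right fun z hz => hz.1
  · rintro p ⟨hp, hp'⟩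
    have h2 : (n:ℝ)+1 < p.2 := by
      by_contra h
      exact hp' ⟨hp.1, hp.2, not_lt.1 h⟩
    have : 1 < p.2 / (n+1) := by rwa [one_lt_div hn]
    simp only [cut]
    rw [max_eq_left (by linarith)]
    simp

lemma cut_nonneg (n : ℕ) (z : ℝ) : 0 ≤ cut n z := sq_nonneg _
lemma cut_le_one (n : ℕ) {z : ℝ} (hz : 0 ≤ z) : cut n z ≤ 1 := by
  unfold cut
  have h1 : 0 ≤ z / (n+1) := by positivity
  have h2 : max 0 (1 - z/(n+1)) ≤ 1 := max_le zero_le_one (by linarith)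
  have h3 : 0 ≤ max 0 (1 - z/(n+1)) := le_max_left _ _
  nlinarith
lemma cut_mono {m n : ℕ} (hmn : m ≤ n) {z : ℝ} (hz : 0 ≤ z) : cut m z ≤ cut n z := by
  unfold cut
  have : z / (n+1) ≤ z / (m+1) := by gcongr
  have h : max 0 (1 - z/(m+1)) ≤ max 0 (1 - z/(n+1)) := max_le_max le_rfl (by linarith)
  exact pow_le_pow_left₀ (le_max_left _ _) h 2
lemma cut_tendsto (z : ℝ) : Tendsto (fun n => cut n z) atTop (𝓝 1) := by
  have h0 : Tendsto (fun n : ℕ => z / ((n:ℝ)+1)) atTop (𝓝 0) :=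
    Tendsto.div_atTop tendsto_const_nhds
      (tendsto_atTop_add_const_right _ _ tendsto_natCast_atTop_atTop)
  have := ((tendsto_const_nhds (x := (0:ℝ))).max (h0.const_sub 1)).pow 2
  simpa [cut] using this
lemma cut_continuous (n : ℕ) : Continuous (cut n) := by
  unfold cut; fun_prop

lemma ae_pos : ∀ᵐ p ∂μΩ, 0 < p.2 := by
  rw [μΩ_eq]
  filter_upwards [ae_restrict_mem (measurableSet_Ioc.prod measurableSet_Ioi)] with p hp
  exact hp.2

lemma cut_int (n : ℕ) {g : ℝ × ℝ → ℝ} (hi : Integrable g μΩ) :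
    Integrable (fun p => cut n p.2 * g p) μΩ := by
  refine hi.bdd_mul (c := 1) ((cut_continuous n).comp continuous_snd).aestronglyMeasurable ?_
  filter_upwards [ae_pos] with p hp
  rw [Real.norm_of_nonneg (cut_nonneg _ _)]
  exact cut_le_one n hp.le

lemma cutI_tendsto {g : ℝ × ℝ → ℝ} (hi : Integrable g μΩ) :
    Tendsto (fun n : ℕ => ∫ p in bx 0 (n+1), (1 - p.2/(n+1))^2 * g p) atTop (𝓝 (∫ p, g p ∂μΩ)) := by
  simp only [cut_eq]
  refine tendsto_integral_of_dominated_convergence (fun p => ‖g p‖)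
    (fun n => (cut_int n hi).aestronglyMeasurable) hi.norm (fun n => ?_) ?_
  · filter_upwards [ae_pos] with p hp
    rw [norm_mul, Real.norm_of_nonneg (cut_nonneg _ _)]
    exact mul_le_of_le_one_left (norm_nonneg _) (cut_le_one n hp.le)
  · refine ae_of_all _ fun p => ?_
    simpa using (cut_tendsto p.2).mul_const (g p)

lemma cutI_mono {g : ℝ × ℝ → ℝ} (hg : ∀ p, 0 ≤ g p) (hi : Integrable g μΩ) :
    Monotone (fun n : ℕ => ∫ p in bx 0 (n+1), (1 - p.2/(n+1))^2 * g p) := by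
  intro m n hmn
  simp only [cut_eq]
  refine integral_mono_ae (cut_int m hi) (cut_int n hi) ?_
  filter_upwards [ae_pos] with p hp
  exact mul_le_mul_of_nonneg_right (cut_mono hmn hp.le) (hg p)

lemma cutI_le {g : ℝ × ℝ → ℝ} (hg : ∀ p, 0 ≤ g p) (hi : Integrable g μΩ) (n : ℕ) :
    ∫ p in bx 0 (n+1), (1 - p.2/(n+1))^2 * g p ≤ ∫ p, g p ∂μΩ :=
  (cutI_mono hg hi).ge_of_tendsto (cutI_tendsto hi) n

lemma bxI_le {g : ℝ × ℝ → ℝ} (hg : ∀ p, 0 ≤ g p) (hi : Integrable g μΩ) (R : ℝ) :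
    ∫ p in bx 0 R, g p ≤ ∫ p, g p ∂μΩ := by
  rw [bx_restrict, μΩ_eq]
  rw [μΩ_eq] at hi
  exact setIntegral_mono_set hi (ae_of_all _ hg)
    (LE.le.eventuallyLE (prod_mono_right fun z hz => hz.1))

lemma bx_split {g : ℝ × ℝ → ℝ} (hc : Continuous g) {a R : ℝ} (ha : 0 ≤ a) (haR : a ≤ R) :
    ∫ p in bx 0 R, g p = (∫ p in bx 0 a, g p) + ∫ p in bx a R, g p := by
  have key : ∀ c d : ℝ, c ≤ d → ∫ p in bx c d, g p = ∫ x in Icc (0:ℝ) 1, ∫ z in c..d, g (x, z) := by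
    intro c d hcd
    unfold bx
    rw [Measure.volume_eq_prod, setIntegral_prod]
    · refine setIntegral_congr_fun measurableSet_Icc fun x hx => ?_
      rw [integral_Icc_eq_integral_Ioc, ← intervalIntegral.integral_of_le hcd]
    · exact hc.continuousOn.integrableOn_compact (bx_compact c d)
  have hcz : ∀ x : ℝ, Continuous fun z : ℝ => g (x, z) := fun x => hc.comp (by fun_prop)
  have hci : ∀ c d : ℝ, IntegrableOn (fun x : ℝ => ∫ z in c..d, g (x, z)) (Icc 0 1) := by
    intro c d
    apply Continuous.integrableOn_Icc
    exact continuous_parametric_intervalIntegral_of_continuous' (f := fun x z => g (x, z)) hc c d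
  rw [key 0 R (ha.trans haR), key 0 a ha, key a R haR, ← integral_add (hci _ _) (hci _ _)]
  refine setIntegral_congr_fun measurableSet_Icc fun x hx => ?_
  rw [intervalIntegral.integral_add_adjacent_intervals] <;> exact (hcz x).intervalIntegrable _ _
/-- pointwise algebraic inequality -/
lemma ptwise_alg {κ χ χ' ζ w wx wz wzz wt u ux uxx bz bxz v U0 U2 Mδ χ2 : ℝ} (hκ : 0 < κ)
    (hχ : 0 ≤ χ) (hχ' : χ' ≤ 0) (hζ : 0 < ζ) (hM : |ζ * U2| ≤ Mδ)
    (heq : wt + U0 * wx + v * U2 - κ * wzz = κ * bxz) :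
    2 * (χ * (w * wt)) ≤ -κ * (χ * (wz^2 + ux^2)) + (4/κ) * Mδ^2 * (χ * w^2)
      + κ * χ2 * (w^2 + bz^2)
      + 2 * (-(χ * U0 * (w * wx)) + κ * χ * (ux * ux + u * uxx) - κ * χ' * (bxz * u + bz * ux))
      + 2 * (κ * (χ' * (w * wz) + χ * (wz * wz + w * wzz))
          - κ * (χ2 * w^2 / 2 + χ' * (w * wz))
          + κ * (χ' * (bxz * u) + χ * (-uxx * u + bxz * w))
          - κ * (χ2 * bz^2 / 2 + χ' * (bz * (-ux)))
          - κ/4 * ((χ' * v^2 + χ * (2 * v * (-ux))) * ζ - χ * v^2) / ζ^2) := by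
  obtain ⟨y, hy⟩ : ∃ y, v = y * ζ := ⟨v / ζ, by field_simp⟩
  obtain ⟨G, hG⟩ : ∃ G, ζ * U2 = G := ⟨_, rfl⟩
  have hv2 : v * U2 = y * G := by rw [hy, ← hG]; ring
  have hwt : wt = κ * bxz - U0 * wx - y * G + κ * wzz := by linarith
  have hdiv : ((χ' * v^2 + χ * (2 * v * (-ux))) * ζ - χ * v^2) / ζ^2
      = χ' * y^2 * ζ - 2 * χ * y * ux - χ * y^2 := by
    rw [hy]; field_simp; ring
  have hdiv' : κ/4 * ((χ' * v^2 + χ * (2 * v * (-ux))) * ζ - χ * v^2) / ζ^2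
      = κ/4 * (χ' * y^2 * ζ - 2 * χ * y * ux - χ * y^2) := by
    rw [mul_div_assoc, hdiv]
  rw [hdiv', hwt]
  rw [hG] at hM
  have hG2 : G^2 ≤ Mδ^2 := by
    rw [← sq_abs G]; exact pow_le_pow_left₀ (abs_nonneg _) hM 2
  have h1 : 0 ≤ (4/κ) * (χ * w^2) * (Mδ^2 - G^2) :=
    mul_nonneg (by positivity) (by linarith)
  have h2 : 0 ≤ (4/κ) * χ * (G * w + κ * y / 4)^2 := by positivity
  have h2' : (4/κ) * χ * (G * w + κ * y / 4)^2
      = (4/κ) * (χ * w^2) * G^2 + 2 * χ * w * G * y + κ / 4 * χ * y^2 := by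
    field_simp; ring
  have h3 : 0 ≤ κ * χ * (ux + y / 2)^2 := by positivity
  have h4 : 0 ≤ κ / 2 * (-χ') * y^2 * ζ := by
    have : 0 ≤ -χ' := by linarith
    positivity
  have h5 : (4/κ) * Mδ^2 * (χ * w^2) = (4/κ) * (χ * w^2) * (Mδ^2 - G^2) + (4/κ) * (χ * w^2) * G^2 := by
    ring
  rw [h5]
  rw [h2'] at h2
  have h6 : 0 ≤ κ * χ * wz^2 := by positivity
  nlinarith [h1, h2, h3, h4, h6]

lemma integral_add5 {α : Type*} [MeasurableSpace α] {μ : Measure α} {f1 f2 f3 f4 f5 : α → ℝ}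
    (i1 : Integrable f1 μ) (i2 : Integrable f2 μ) (i3 : Integrable f3 μ) (i4 : Integrable f4 μ)
    (i5 : Integrable f5 μ) : ∫ p, (f1 p + f2 p + f3 p + f4 p + f5 p) ∂μ
      = (∫ p, f1 p ∂μ) + (∫ p, f2 p ∂μ) + (∫ p, f3 p ∂μ) + (∫ p, f4 p ∂μ) + ∫ p, f5 p ∂μ := by
  have i12 : Integrable (fun p => f1 p + f2 p) μ := i1.add i2
  have i13 : Integrable (fun p => f1 p + f2 p + f3 p) μ := i12.add i3
  have i14 : Integrable (fun p => f1 p + f2 p + f3 p + f4 p) μ := i13.add i4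
  rw [MeasureTheory.integral_add i14 i5, MeasureTheory.integral_add i13 i4,
    MeasureTheory.integral_add i12 i3, MeasureTheory.integral_add i1 i2]

/-- Fixed-time truncated energy inequality, with regularisation `δ`. -/
lemma fixed_time_delta {κ R δ M N : ℝ} (hκ : 0 < κ) (hR : 0 < R) (hδ : 0 < δ)
    {u b wt : ℝ → ℝ → ℝ} {U : ℝ → ℝ} (hu : Sm2 u) (hb : Sm2 b)
    (hwt : Continuous (fun p : ℝ × ℝ => wt p.1 p.2)) (hU : ContDiff ℝ (⊤ : ℕ∞) U)
    (hup : ∀ z, Function.Periodic (fun x => u x z) 1)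
    (hbp : ∀ z, Function.Periodic (fun x => b x z) 1)
    (hu0 : ∀ x, u x 0 = 0) (hw0 : ∀ x, dZ (dZ u) x 0 = 0)
    (hcon : ∀ x, ∀ z ∈ Ici (0:ℝ), dX u x z + dZ (dZ b) x z = 0)
    (heq : ∀ x, ∀ z ∈ Ici (0:ℝ), wt x z + U z * dX (dZ u) x z
      + (dZ b x z - dZ b x 0) * deriv (deriv U) z - κ * dZ (dZ (dZ u)) x z = κ * dX (dZ b) x z)
    (hM : ∀ z ∈ Ici (0:ℝ), |z * deriv (deriv U) z| ≤ M)
    (hN : ∀ z ∈ Icc 0 R, |deriv (deriv U) z| ≤ N) :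
    ∫ p in bx 0 R, 2 * ((1 - p.2/R)^2 * (dZ u p.1 p.2 * wt p.1 p.2))
      ≤ -κ * (∫ p in bx 0 R, (1 - p.2/R)^2 * ((dZ (dZ u) p.1 p.2)^2 + (dX u p.1 p.2)^2))
        + (4/κ) * (M + δ * N)^2 * (∫ p in bx 0 R, (1 - p.2/R)^2 * (dZ u p.1 p.2)^2)
        + κ * (2/R^2) * ∫ p in bx 0 R, ((dZ u p.1 p.2)^2 + (dZ b p.1 p.2)^2) := by
  -- periodicity of derivatives
  have perX : ∀ {g : ℝ → ℝ → ℝ}, (∀ z, Function.Periodic (fun x => g x z) 1) →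
      ∀ z, Function.Periodic (fun x => dX g x z) 1 := by
    intro g hg z x
    show deriv (fun x' => g x' z) (x + 1) = deriv (fun x' => g x' z) x
    rw [← deriv_comp_add_const]
    congr 1; ext y; exact hg z y
  have perZ : ∀ {g : ℝ → ℝ → ℝ}, (∀ z, Function.Periodic (fun x => g x z) 1) →
      ∀ z, Function.Periodic (fun x => dZ g x z) 1 := by
    intro g hg z x
    show deriv (fun z' => g (x+1) z') z = deriv (fun z' => g x z') z
    congr 1; ext y; exact hg y x
  have per1 : ∀ {g : ℝ → ℝ → ℝ}, (∀ z, Function.Periodic (fun x => g x z) 1) → ∀ z, g 1 z = g 0 z := by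
    intro g hg z; simpa using hg z 0
  have cu := hu.cont
  have cux := hu.dX.cont
  have cuxx := hu.dX.dX.cont
  have cw := hu.dZ.cont
  have cwx := hu.dZ.dX.cont
  have cwz := hu.dZ.dZ.cont
  have cwzz := hu.dZ.dZ.dZ.cont
  have cbz := hb.dZ.cont
  have cbxz := hb.dZ.dX.cont
  have cbz0 : Continuous (fun p : ℝ × ℝ => dZ b p.1 0) :=
    cbz.comp (by fun_prop : Continuous fun p : ℝ × ℝ => (p.1, (0:ℝ)))
  have cU : Continuous (fun p : ℝ × ℝ => U p.2) := hU.continuous.comp continuous_snd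
  -- P
  let χ : ℝ → ℝ := fun z => (1 - z/R)^2
  let χ' : ℝ → ℝ := fun z => -2/R * (1 - z/R)
  have hχd : ∀ z, HasDerivAt χ (χ' z) z := by
    intro z
    have h := (((hasDerivAt_id z).div_const R).const_sub 1).pow 2
    refine h.congr_deriv ?_
    simp [χ']; ring
  have hχ'd : ∀ z, HasDerivAt χ' (2/R^2) z := by
    intro z
    have h := (((hasDerivAt_id z).div_const R).const_sub 1).const_mul (-2/R)
    refine h.congr_deriv ?_
    field_simp
  have cχ : Continuous (fun p : ℝ × ℝ => χ p.2) := by dsimp only [χ]; fun_prop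
  have cχ' : Continuous (fun p : ℝ × ℝ => χ' p.2) := by dsimp only [χ']; fun_prop
  let P : ℝ → ℝ → ℝ := fun x z => -(χ z * U z * ((dZ u x z)^2 / 2)) + κ * χ z * (u x z * dX u x z)
    - κ * χ' z * (dZ b x z * u x z)
  let Px : ℝ → ℝ → ℝ := fun x z => -(χ z * U z * (dZ u x z * dX (dZ u) x z))
    + κ * χ z * (dX u x z * dX u x z + u x z * dX (dX u) x z)
    - κ * χ' z * (dX (dZ b) x z * u x z + dZ b x z * dX u x z)
  have hPint : ∫ p in bx 0 R, Px p.1 p.2 = 0 := by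
    refine divX P Px ?_ ?_ ?_
    · dsimp only [Px]; fun_prop
    · intro x z
      have h1 := (((hu.dZ.hX x z).pow 2).div_const 2).const_mul (χ z * U z)
      have h2 := ((hu.hX x z).mul (hu.dX.hX x z)).const_mul (κ * χ z)
      have h3 := ((hb.dZ.hX x z).mul (hu.hX x z)).const_mul (κ * χ' z)
      refine ((h1.neg.add h2).sub h3).congr_deriv ?_
      simp only [Px]; push_cast; ring
    · intro z
      simp only [P, per1 hup, per1 (perZ hup), per1 (perX hup), per1 (perZ hbp)]
  let Q : ℝ → ℝ → ℝ := fun x z => κ * (χ z * (dZ u x z * dZ (dZ u) x z))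
    - κ * (χ' z * (dZ u x z)^2 / 2) + κ * (χ z * (dX (dZ b) x z * u x z))
    - κ * (χ' z * (dZ b x z)^2 / 2) - κ/4 * ((χ z * (dZ b x z - dZ b x 0)^2) / (z + δ))
  let Qz : ℝ → ℝ → ℝ := fun x z =>
    κ * (χ' z * (dZ u x z * dZ (dZ u) x z)
      + χ z * (dZ (dZ u) x z * dZ (dZ u) x z + dZ u x z * dZ (dZ (dZ u)) x z))
    - κ * (2/R^2 * (dZ u x z)^2 / 2 + χ' z * (dZ u x z * dZ (dZ u) x z))
    + κ * (χ' z * (dX (dZ b) x z * u x z) + χ z * (-dX (dX u) x z * u x z + dX (dZ b) x z * dZ u x z))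
    - κ * (2/R^2 * (dZ b x z)^2 / 2 + χ' z * (dZ b x z * (-dX u x z)))
    - κ/4 * ((χ' z * (dZ b x z - dZ b x 0)^2 + χ z * (2 * (dZ b x z - dZ b x 0) * (-dX u x z))) * (z+δ)
      - χ z * (dZ b x z - dZ b x 0)^2) / (z+δ)^2
  have hQc : ContinuousOn (fun p : ℝ × ℝ => Qz p.1 p.2) (bx 0 R) := by
    dsimp only [Qz]
    refine ContinuousOn.sub (Continuous.continuousOn (by fun_prop)) ?_
    refine ContinuousOn.div (Continuous.continuousOn (by fun_prop))
      (Continuous.continuousOn (by fun_prop)) ?_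
    intro p hp
    have : 0 < p.2 + δ := by linarith [hp.2.1]
    positivity
  have hbzz : ∀ x, ∀ z ∈ Ici (0:ℝ), dZ (dZ b) x z = -dX u x z := fun x z hz => by
    linarith [hcon x z hz]
  have hbxzz : ∀ x, ∀ z ∈ Ici (0:ℝ), dZ (dX (dZ b)) x z = -dX (dX u) x z := by
    intro x z hz
    rw [hb.dZ.comm]
    show deriv (fun x' => dZ (dZ b) x' z) x = - deriv (fun x' => dX u x' z) x
    rw [← deriv.fun_neg]
    congr 1; ext x'; exact hbzz x' z hz
  have hQint : ∫ p in bx 0 R, Qz p.1 p.2 = ∫ x in Icc (0:ℝ) 1, (Q x R - Q x 0) := by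
    refine divZ hR.le Q Qz hQc ?_
    intro x z hz
    have hz0 : z ∈ Ici (0:ℝ) := hz.1
    have hzδ : z + δ ≠ 0 := by have := hz.1; positivity
    have hbz := hb.dZ.hZ x z
    rw [hbzz x z hz0] at hbz
    have hbxz := hb.dZ.dX.hZ x z
    rw [hbxzz x z hz0] at hbxz
    have h1 := ((hχd z).mul ((hu.dZ.hZ x z).mul (hu.dZ.dZ.hZ x z))).const_mul κ
    have h2 := (((hχ'd z).mul ((hu.dZ.hZ x z).pow 2)).div_const 2).const_mul κ
    have h3 := ((hχd z).mul (hbxz.mul (hu.hZ x z))).const_mul κ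
    have h4 := (((hχ'd z).mul (hbz.pow 2)).div_const 2).const_mul κ
    have h5 := (((hχd z).mul ((hbz.sub_const (dZ b x 0)).pow 2)).div
      ((hasDerivAt_id z).add_const δ) hzδ).const_mul (κ/4)
    refine ((((h1.sub h2).add h3).sub h4).sub h5).congr_deriv ?_
    simp only [Qz, id]
    push_cast
    simp only [Pi.mul_apply, Pi.pow_apply, mul_div_assoc]
    ring
  have hQle : ∫ p in bx 0 R, Qz p.1 p.2 ≤ 0 := by
    rw [hQint]
    refine setIntegral_nonpos measurableSet_Icc fun x _ => ?_
    have hχR : χ R = 0 := by simp only [χ]; rw [div_self hR.ne']; ring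
    have hχ'R : χ' R = 0 := by simp only [χ']; rw [div_self hR.ne']; ring
    have hχ'0 : χ' 0 = -2/R := by simp [χ']
    simp only [Q, hχR, hχ'R, hχ'0, hu0, hw0]
    have : 0 ≤ κ * (2/R * (dZ u x 0)^2/2) + κ * (2/R * (dZ b x 0)^2/2) := by positivity
    have e : (-2:ℝ)/R = -(2/R) := by ring
    rw [e]
    simp only [mul_zero, zero_mul, sub_self, zero_div, zero_pow two_ne_zero, zero_add, add_zero, zero_sub]
    linarith
  have int : ∀ {f : ℝ × ℝ → ℝ}, ContinuousOn f (bx 0 R) → IntegrableOn f (bx 0 R) :=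
    fun hf => hf.integrableOn_compact (bx_compact 0 R)
  have c1 : Continuous fun p : ℝ × ℝ => χ p.2 * ((dZ (dZ u) p.1 p.2)^2 + (dX u p.1 p.2)^2) := by fun_prop
  have c2 : Continuous fun p : ℝ × ℝ => χ p.2 * (dZ u p.1 p.2)^2 := by fun_prop
  have c3 : Continuous fun p : ℝ × ℝ => (dZ u p.1 p.2)^2 + (dZ b p.1 p.2)^2 := by fun_prop
  have cPx : Continuous fun p : ℝ × ℝ => Px p.1 p.2 := by dsimp only [Px]; fun_prop
  have i1 := (int c1.continuousOn).const_mul (-κ)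
  have i2 := (int c2.continuousOn).const_mul ((4/κ) * (M + δ * N)^2)
  have i3 := (int c3.continuousOn).const_mul (κ * (2/R^2))
  have i4 := (int cPx.continuousOn).const_mul 2
  have i5 := (int hQc).const_mul 2
  have main : ∫ p in bx 0 R, 2 * (χ p.2 * (dZ u p.1 p.2 * wt p.1 p.2)) ≤
      ∫ p in bx 0 R, (-κ * (χ p.2 * ((dZ (dZ u) p.1 p.2)^2 + (dX u p.1 p.2)^2))
        + (4/κ) * (M + δ * N)^2 * (χ p.2 * (dZ u p.1 p.2)^2)
        + κ * (2/R^2) * ((dZ u p.1 p.2)^2 + (dZ b p.1 p.2)^2)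
        + 2 * Px p.1 p.2 + 2 * Qz p.1 p.2) := by
    refine setIntegral_mono_on (int (Continuous.continuousOn (by fun_prop)))
      ((((i1.add i2).add i3).add i4).add i5) (bx_meas 0 R) ?_
    rintro ⟨x, z⟩ ⟨hx, hz⟩
    have hz0 : z ∈ Ici (0:ℝ) := hz.1
    have hz0' : 0 ≤ z := hz.1
    have hzR : z / R ≤ 1 := by rw [div_le_one hR]; exact hz.2
    refine ptwise_alg (v := dZ b x z - dZ b x 0) (U2 := deriv (deriv U) z) hκ (sq_nonneg _) ?_
      (by positivity : 0 < z + δ) ?_ (heq x z hz0)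
    · have : 0 ≤ 2/R * (1 - z/R) := mul_nonneg (by positivity) (by linarith)
      have e : χ' z = -(2/R * (1 - z/R)) := by simp only [χ']; ring
      rw [e]; linarith
    · rw [add_mul]
      refine (abs_add_le _ _).trans (add_le_add (hM z hz0) ?_)
      rw [abs_mul, abs_of_pos hδ]
      exact mul_le_mul_of_nonneg_left (hN z hz) hδ.le
  have esum : ∫ p in bx 0 R, (-κ * (χ p.2 * ((dZ (dZ u) p.1 p.2)^2 + (dX u p.1 p.2)^2))
        + (4/κ) * (M + δ * N)^2 * (χ p.2 * (dZ u p.1 p.2)^2)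
        + κ * (2/R^2) * ((dZ u p.1 p.2)^2 + (dZ b p.1 p.2)^2)
        + 2 * Px p.1 p.2 + 2 * Qz p.1 p.2)
      = -κ * (∫ p in bx 0 R, χ p.2 * ((dZ (dZ u) p.1 p.2)^2 + (dX u p.1 p.2)^2))
        + (4/κ) * (M + δ * N)^2 * (∫ p in bx 0 R, χ p.2 * (dZ u p.1 p.2)^2)
        + κ * (2/R^2) * (∫ p in bx 0 R, ((dZ u p.1 p.2)^2 + (dZ b p.1 p.2)^2))
        + 2 * (∫ p in bx 0 R, Px p.1 p.2) + 2 * ∫ p in bx 0 R, Qz p.1 p.2 := by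
    rw [integral_add5 i1 i2 i3 i4 i5]
    simp only [MeasureTheory.integral_const_mul]
  rw [esum, hPint] at main
  linarith

lemma fixed_time {κ R M : ℝ} (hκ : 0 < κ) (hR : 0 < R)
    {u b wt : ℝ → ℝ → ℝ} {U : ℝ → ℝ} (hu : Sm2 u) (hb : Sm2 b)
    (hwt : Continuous (fun p : ℝ × ℝ => wt p.1 p.2)) (hU : ContDiff ℝ (⊤ : ℕ∞) U)
    (hup : ∀ z, Function.Periodic (fun x => u x z) 1)
    (hbp : ∀ z, Function.Periodic (fun x => b x z) 1)
    (hu0 : ∀ x, u x 0 = 0) (hw0 : ∀ x, dZ (dZ u) x 0 = 0)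
    (hcon : ∀ x, ∀ z ∈ Ici (0:ℝ), dX u x z + dZ (dZ b) x z = 0)
    (heq : ∀ x, ∀ z ∈ Ici (0:ℝ), wt x z + U z * dX (dZ u) x z
      + (dZ b x z - dZ b x 0) * deriv (deriv U) z - κ * dZ (dZ (dZ u)) x z = κ * dX (dZ b) x z)
    (hM : ∀ z ∈ Ici (0:ℝ), |z * deriv (deriv U) z| ≤ M) :
    ∫ p in bx 0 R, 2 * ((1 - p.2/R)^2 * (dZ u p.1 p.2 * wt p.1 p.2))
      ≤ -κ * (∫ p in bx 0 R, (1 - p.2/R)^2 * ((dZ (dZ u) p.1 p.2)^2 + (dX u p.1 p.2)^2))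
        + (4/κ) * M^2 * (∫ p in bx 0 R, (1 - p.2/R)^2 * (dZ u p.1 p.2)^2)
        + κ * (2/R^2) * ∫ p in bx 0 R, ((dZ u p.1 p.2)^2 + (dZ b p.1 p.2)^2) := by
  have hU2 : Continuous (deriv (deriv U)) := by
    have h1 : ContDiff ℝ (⊤ : ℕ∞) (deriv U) := (contDiff_infty_iff_deriv.1 hU).2
    exact (contDiff_infty_iff_deriv.1 h1).2.continuous
  obtain ⟨N, hN⟩ := (isCompact_Icc (a := (0:ℝ)) (b := R)).exists_bound_of_continuousOn hU2.continuousOn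
  have hlim : Tendsto (fun δ : ℝ =>
      -κ * (∫ p in bx 0 R, (1 - p.2/R)^2 * ((dZ (dZ u) p.1 p.2)^2 + (dX u p.1 p.2)^2))
        + (4/κ) * (M + δ * N)^2 * (∫ p in bx 0 R, (1 - p.2/R)^2 * (dZ u p.1 p.2)^2)
        + κ * (2/R^2) * ∫ p in bx 0 R, ((dZ u p.1 p.2)^2 + (dZ b p.1 p.2)^2)) (𝓝[>] 0)
      (𝓝 (-κ * (∫ p in bx 0 R, (1 - p.2/R)^2 * ((dZ (dZ u) p.1 p.2)^2 + (dX u p.1 p.2)^2))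
        + (4/κ) * (M + 0 * N)^2 * (∫ p in bx 0 R, (1 - p.2/R)^2 * (dZ u p.1 p.2)^2)
        + κ * (2/R^2) * ∫ p in bx 0 R, ((dZ u p.1 p.2)^2 + (dZ b p.1 p.2)^2))) := by
    refine Tendsto.mono_left ?_ nhdsWithin_le_nhds
    exact Continuous.tendsto (by fun_prop) 0
  rw [zero_mul, add_zero] at hlim
  refine ge_of_tendsto hlim ?_
  filter_upwards [self_mem_nhdsWithin] with δ hδ
  exact fixed_time_delta hκ hR hδ hu hb hwt hU hup hbp hu0 hw0 hcon heq hM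
    (fun z hz => hN z hz)

/-- control of the error term -/
lemma err_bound {a R : ℝ} (ha : 0 ≤ a) (haR : a ≤ R) {u b : ℝ → ℝ → ℝ} (hu : Sm2 u) (hb : Sm2 b)
    (hcon : ∀ x, ∀ z ∈ Ici (0:ℝ), dX u x z + dZ (dZ b) x z = 0) :
    ∫ p in bx a R, (dZ b p.1 p.2)^2 ≤ 4 * R^2 * (∫ p in bx a R, (dX u p.1 p.2)^2)
      + 2 * R * ∫ x in Icc (0:ℝ) 1, (dZ b x a)^2 := by
  have cux := hu.dX.cont
  have cbz := hb.dZ.cont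
  have cbza : Continuous (fun x : ℝ => dZ b x a) :=
    cbz.comp (by fun_prop : Continuous fun x : ℝ => (x, a))
  let Q : ℝ → ℝ → ℝ := fun x z => (R - z) * (dZ b x z)^2
  let Qz : ℝ → ℝ → ℝ := fun x z => -(dZ b x z)^2 + (R - z) * (2 * dZ b x z * (-dX u x z))
  have cQz : Continuous fun p : ℝ × ℝ => Qz p.1 p.2 := by dsimp only [Qz]; fun_prop
  have hQ := divZ haR Q Qz cQz.continuousOn (by
    intro x z hz
    have hbz := hb.dZ.hZ x z
    have : dZ (dZ b) x z = -dX u x z := by linarith [hcon x z (ha.trans hz.1)]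
    rw [this] at hbz
    refine (((hasDerivAt_id z).const_sub R).mul (hbz.pow 2)).congr_deriv ?_
    simp only [Qz, id]
    push_cast
    simp only [Pi.pow_apply]
    ring)
  have int : ∀ {f : ℝ × ℝ → ℝ}, Continuous f → IntegrableOn f (bx a R) :=
    fun hf => hf.continuousOn.integrableOn_compact (bx_compact a R)
  have c1 : Continuous fun p : ℝ × ℝ => (dX u p.1 p.2)^2 := by fun_prop
  have main : ∫ p in bx a R, (dZ b p.1 p.2)^2 ≤
      ∫ p in bx a R, (4 * R^2 * (dX u p.1 p.2)^2 + (-2) * Qz p.1 p.2) := by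
    refine setIntegral_mono_on (int (by fun_prop)) (int (by fun_prop)) (bx_meas a R) ?_
    rintro ⟨x, z⟩ ⟨hx, hz⟩
    have h0 : 0 ≤ R - z := by linarith [hz.2]
    have h1 : R - z ≤ R := by linarith [hz.1]
    have h2 : 0 ≤ (R^2 - (R-z)^2) * (dX u x z)^2 := by
      apply mul_nonneg _ (sq_nonneg _)
      nlinarith
    simp only [Qz]
    nlinarith [sq_nonneg (dZ b x z + 2 * (R - z) * dX u x z)]
  rw [integral_add ((int c1).const_mul _) ((int cQz).const_mul _), MeasureTheory.integral_const_mul,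
    MeasureTheory.integral_const_mul, hQ] at main
  have e : ∫ x in Icc (0:ℝ) 1, (Q x R - Q x a) = -(R - a) * ∫ x in Icc (0:ℝ) 1, (dZ b x a)^2 := by
    rw [← MeasureTheory.integral_const_mul]
    congr 1; ext x; simp only [Q]; ring
  rw [e] at main
  have h3 : 0 ≤ ∫ x in Icc (0:ℝ) 1, (dZ b x a)^2 := MeasureTheory.integral_nonneg fun x => sq_nonneg _
  nlinarith [mul_nonneg ha h3]

lemma ext_Ici {f g : ℝ → ℝ} (hf : Continuous f) (hg : Continuous g)
    (h : ∀ z ∈ Ioi (0:ℝ), f z = g z) : ∀ z ∈ Ici (0:ℝ), f z = g z := by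
  intro z hz
  have h1 : EqOn f g (closure (Ioi (0:ℝ))) := Set.EqOn.closure (fun z hz => h z hz) hf hg
  rw [closure_Ioi] at h1
  exact h1 hz

lemma r_split {R : ℝ} {u b : ℝ → ℝ → ℝ} (hu : Sm2 u) (hb : Sm2 b) :
    ∫ p in bx 0 R, ((dZ u p.1 p.2)^2 + (dZ b p.1 p.2)^2)
      = (∫ p in bx 0 R, (dZ u p.1 p.2)^2) + ∫ p in bx 0 R, (dZ b p.1 p.2)^2 := by
  have cw := hu.dZ.cont
  have cbz := hb.dZ.cont
  have c1 : Continuous fun p : ℝ × ℝ => (dZ u p.1 p.2)^2 := by fun_prop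
  have c2 : Continuous fun p : ℝ × ℝ => (dZ b p.1 p.2)^2 := by fun_prop
  exact MeasureTheory.integral_add (c1.continuousOn.integrableOn_compact (bx_compact 0 R))
    (c2.continuousOn.integrableOn_compact (bx_compact 0 R))

/-- uniform bound on the error term -/
lemma r_bound {κ R : ℝ} (hκ : 0 < κ) (hR : 1 ≤ R) {u b : ℝ → ℝ → ℝ} (hu : Sm2 u) (hb : Sm2 b)
    (hcon : ∀ x, ∀ z ∈ Ici (0:ℝ), dX u x z + dZ (dZ b) x z = 0)
    (iw : Integrable (fun p : ℝ × ℝ => (dZ u p.1 p.2)^2) μΩ)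
    (iu : Integrable (fun p : ℝ × ℝ => (dX u p.1 p.2)^2) μΩ) :
    κ * (2/R^2) * ∫ p in bx 0 R, ((dZ u p.1 p.2)^2 + (dZ b p.1 p.2)^2)
      ≤ 8 * κ * sqL2 (dX u) + (2 * κ * sqL2 (dZ u) + 4 * κ * ∫ x in Icc (0:ℝ) 1, (dZ b x 0)^2) := by
  have hR0 : 0 < R := by linarith
  rw [r_split hu hb]
  have h1 := bxI_le (fun p => sq_nonneg _) iw R
  have h2 := err_bound le_rfl hR0.le hu hb hcon
  have h3 := bxI_le (fun p => sq_nonneg _) iu R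
  have h4 : 0 ≤ ∫ x in Icc (0:ℝ) 1, (dZ b x 0)^2 := MeasureTheory.integral_nonneg fun x => sq_nonneg _
  have h5 : 0 ≤ ∫ p, (dZ u p.1 p.2)^2 ∂μΩ := MeasureTheory.integral_nonneg fun x => sq_nonneg _
  unfold sqL2
  set W := ∫ p, (dZ u p.1 p.2)^2 ∂μΩ
  set X := ∫ p, (dX u p.1 p.2)^2 ∂μΩ
  set B := ∫ x in Icc (0:ℝ) 1, (dZ b x 0)^2
  have hRR : R ≤ R^2 := by nlinarith
  have h6 : (∫ p in bx 0 R, (dZ u p.1 p.2)^2) + (∫ p in bx 0 R, (dZ b p.1 p.2)^2)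
      ≤ R^2 * (W + 4 * X + 2 * B) := by
    have h7 : 4 * R^2 * (∫ p in bx 0 R, (dX u p.1 p.2)^2) ≤ 4 * R^2 * X := by gcongr
    have h8 : R * B ≤ R^2 * B := by gcongr
    have h9 : 1 * W ≤ R^2 * W := by gcongr; linarith
    linarith
  calc _ ≤ κ * (2/R^2) * (R^2 * (W + 4 * X + 2 * B)) := by gcongr
    _ = _ := by field_simp; ring

/-- the error term vanishes in the limit -/
lemma r_tendsto {κ : ℝ} (hκ : 0 < κ) {u b : ℝ → ℝ → ℝ} (hu : Sm2 u) (hb : Sm2 b)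
    (hcon : ∀ x, ∀ z ∈ Ici (0:ℝ), dX u x z + dZ (dZ b) x z = 0)
    (iw : Integrable (fun p : ℝ × ℝ => (dZ u p.1 p.2)^2) μΩ)
    (iu : Integrable (fun p : ℝ × ℝ => (dX u p.1 p.2)^2) μΩ) :
    Tendsto (fun n : ℕ => κ * (2/((n:ℝ)+1)^2) *
      ∫ p in bx 0 ((n:ℝ)+1), ((dZ u p.1 p.2)^2 + (dZ b p.1 p.2)^2)) atTop (𝓝 0) := by
  have cux := hu.dX.cont
  have cbz := hb.dZ.cont
  have cux2 : Continuous fun p : ℝ × ℝ => (dX u p.1 p.2)^2 := by fun_prop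
  have cbz2 : Continuous fun p : ℝ × ℝ => (dZ b p.1 p.2)^2 := by fun_prop
  set W := ∫ p, (dZ u p.1 p.2)^2 ∂μΩ
  set X := ∫ p, (dX u p.1 p.2)^2 ∂μΩ with hX
  have h0 : Tendsto (fun n : ℕ => ((n:ℝ)+1)⁻¹) atTop (𝓝 0) :=
    tendsto_inv_atTop_zero.comp (tendsto_atTop_add_const_right _ _ tendsto_natCast_atTop_atTop)
  have hbd : ∀ m n : ℕ, m ≤ n → κ * (2/((n:ℝ)+1)^2) *
      (∫ p in bx 0 ((n:ℝ)+1), ((dZ u p.1 p.2)^2 + (dZ b p.1 p.2)^2))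
      ≤ 2 * κ * ((W + ∫ p in bx 0 ((m:ℝ)+1), (dZ b p.1 p.2)^2) * (((n:ℝ)+1)⁻¹)^2
        + (2 * ∫ x in Icc (0:ℝ) 1, (dZ b x ((m:ℝ)+1))^2) * ((n:ℝ)+1)⁻¹
        + 4 * (X - ∫ p in bx 0 ((m:ℝ)+1), (dX u p.1 p.2)^2)) := by
    intro m n hmn
    have hm : (0:ℝ) ≤ (m:ℝ)+1 := by positivity
    have hn : (0:ℝ) < (n:ℝ)+1 := by positivity
    have hmn' : (m:ℝ)+1 ≤ (n:ℝ)+1 := by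
      have : (m:ℝ) ≤ n := by exact_mod_cast hmn
      linarith
    rw [r_split hu hb, bx_split cbz2 hm hmn']
    have h1 := bxI_le (fun p => sq_nonneg _) iw ((n:ℝ)+1)
    have h2 := err_bound hm hmn' hu hb hcon
    have h3 := bxI_le (fun p => sq_nonneg _) iu ((n:ℝ)+1)
    rw [bx_split cux2 hm hmn'] at h3
    set R := (n:ℝ)+1
    set a := (m:ℝ)+1
    set B := ∫ x in Icc (0:ℝ) 1, (dZ b x a)^2
    have h4 : 4 * R^2 * (∫ p in bx a R, (dX u p.1 p.2)^2)
        ≤ 4 * R^2 * (X - ∫ p in bx 0 a, (dX u p.1 p.2)^2) := by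
      gcongr
      linarith
    calc _ ≤ κ * (2/R^2) * (W + ((∫ p in bx 0 a, (dZ b p.1 p.2)^2) +
          (4 * R^2 * (X - ∫ p in bx 0 a, (dX u p.1 p.2)^2) + 2 * R * B))) := by
            gcongr
            linarith
      _ = _ := by field_simp; ring
  have htail : Tendsto (fun m : ℕ => 2 * κ * (4 * (X - ∫ p in bx 0 ((m:ℝ)+1), (1 - p.2/((m:ℝ)+1))^2 *
      (dX u p.1 p.2)^2))) atTop (𝓝 0) := by
    have := ((((cutI_tendsto iu).const_sub X).const_mul 4).const_mul (2*κ))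
    simpa [hX] using this
  have hcut : ∀ m : ℕ, ∫ p in bx 0 ((m:ℝ)+1), (1 - p.2/((m:ℝ)+1))^2 * (dX u p.1 p.2)^2
      ≤ ∫ p in bx 0 ((m:ℝ)+1), (dX u p.1 p.2)^2 := by
    intro m
    have hm : (0:ℝ) < (m:ℝ)+1 := by positivity
    refine setIntegral_mono_on
      (Continuous.continuousOn (by fun_prop) |>.integrableOn_compact (bx_compact _ _))
      (cux2.continuousOn.integrableOn_compact (bx_compact _ _)) (bx_meas _ _) ?_
    rintro ⟨x, z⟩ ⟨_, hz⟩
    have h1 : z / ((m:ℝ)+1) ≤ 1 := by rw [div_le_one hm]; exact hz.2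
    have h2 : 0 ≤ z / ((m:ℝ)+1) := div_nonneg hz.1 hm.le
    refine mul_le_of_le_one_left (sq_nonneg _) ?_
    show (1 - z / ((m:ℝ)+1))^2 ≤ 1
    nlinarith
  rw [Metric.tendsto_atTop']
  intro ε hε
  obtain ⟨m, hm⟩ := (htail.eventually (gt_mem_nhds hε)).exists
  have hlim := (((h0.pow 2).const_mul (W + ∫ p in bx 0 ((m:ℝ)+1), (dZ b p.1 p.2)^2)).add
    (h0.const_mul (2 * ∫ x in Icc (0:ℝ) 1, (dZ b x ((m:ℝ)+1))^2))).add_const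
      (4 * (X - ∫ p in bx 0 ((m:ℝ)+1), (dX u p.1 p.2)^2))
  have hlim2 := hlim.const_mul (2*κ)
  have hlt : 2 * κ * ((W + ∫ p in bx 0 ((m:ℝ)+1), (dZ b p.1 p.2)^2) * 0^2
        + (2 * ∫ x in Icc (0:ℝ) 1, (dZ b x ((m:ℝ)+1))^2) * 0
        + 4 * (X - ∫ p in bx 0 ((m:ℝ)+1), (dX u p.1 p.2)^2)) < ε := by
    refine lt_of_le_of_lt ?_ hm
    have := hcut m
    have : 4 * (X - ∫ p in bx 0 ((m:ℝ)+1), (dX u p.1 p.2)^2) ≤ 4 * (X -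
      ∫ p in bx 0 ((m:ℝ)+1), (1 - p.2/((m:ℝ)+1))^2 * (dX u p.1 p.2)^2) := by linarith
    rw [zero_pow two_ne_zero, mul_zero, mul_zero, add_zero, zero_add]
    gcongr
  obtain ⟨N, hN⟩ := eventually_atTop.1 ((hlim2.eventually (gt_mem_nhds hlt)).and
    (eventually_ge_atTop m))
  refine ⟨N, fun n hn => ?_⟩
  obtain ⟨h1, h2⟩ := hN n hn.le
  rw [Real.dist_eq, sub_zero, abs_of_nonneg]
  · exact (hbd m n h2).trans_lt h1
  · refine mul_nonneg (by positivity) (MeasureTheory.integral_nonneg fun p => ?_)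
    positivity

theorem energy_aux (T κ : ℝ) (hκ : 0 < κ)
    (u b : ℝ → ℝ → ℝ → ℝ) (U : ℝ → ℝ) (M : ℝ)
    (hu : Sm u) (hb : Sm b)
    (hU : ContDiff ℝ (⊤ : ℕ∞) U)
    (hup : ∀ t z, Function.Periodic (fun x => u t x z) 1)
    (hbp : ∀ t z, Function.Periodic (fun x => b t x z) 1)
    (hu0 : ∀ t x, u t x 0 = 0)
    (hw0 : ∀ t x, dZ (dZ (u t)) x 0 = 0)
    (hcon : ∀ t ∈ Ioo 0 T, ∀ x, ∀ z ∈ Ici (0:ℝ), dX (u t) x z + dZ (dZ (b t)) x z = 0)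
    (heq : ∀ t ∈ Ioo 0 T, ∀ (x : ℝ), ∀ z ∈ Ici (0:ℝ),
        deriv (fun s => dZ (u s) x z) t + U z * dX (dZ (u t)) x z
          + (dZ (b t) x z - dZ (b t) x 0) * deriv (deriv U) z - κ * dZ (dZ (dZ (u t))) x z
          = κ * dX (dZ (b t)) x z)
    (hzU : ∀ z ∈ Ici (0:ℝ), |z * deriv (deriv U) z| ≤ M)
    (hint : ∀ t ∈ Ioo 0 T,
        Integrable (fun p : ℝ × ℝ => (dZ (u t) p.1 p.2)^2) μΩ ∧
        Integrable (fun p : ℝ × ℝ => (dX (u t) p.1 p.2)^2) μΩ ∧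
        Integrable (fun p : ℝ × ℝ => (dZ (dZ (u t)) p.1 p.2)^2) μΩ)
    (hE : DifferentiableOn ℝ (fun s => sqL2 (dZ (u s))) (Ioo 0 T)) :
    ∀ t ∈ Ioo 0 T, deriv (fun s => sqL2 (dZ (u s))) t
        + κ * (sqL2 (dZ (dZ (u t))) + sqL2 (dX (u t))) ≤ (4/κ) * M^2 * sqL2 (dZ (u t)) := by
  have cw := hu.dZ.cont
  have cwt := hu.dZ.dT.cont
  have cwz := hu.dZ.dZ.cont
  have cux := hu.dX.cont
  have cbz := hb.dZ.cont
  have cbz0 : Continuous (fun q : ℝ × ℝ => dZ (b q.1) q.2 0) :=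
    cbz.comp (by fun_prop : Continuous fun q : ℝ × ℝ => (q.1, q.2, (0:ℝ)))
  refine core (T := T) (E := fun s => sqL2 (dZ (u s)))
    (D := fun t => sqL2 (dZ (dZ (u t))) + sqL2 (dX (u t)))
    (β := fun t => 2 * κ * sqL2 (dZ (u t)) + 4 * κ * ∫ x in Icc (0:ℝ) 1, (dZ (b t) x 0)^2)
    (e := fun n t => ∫ p in bx 0 ((n:ℝ)+1), (1 - p.2/((n:ℝ)+1))^2 * (dZ (u t) p.1 p.2)^2)
    (e' := fun n t => ∫ p in bx 0 ((n:ℝ)+1), 2 * ((1 - p.2/((n:ℝ)+1))^2 *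
      (dZ (u t) p.1 p.2 * deriv (fun s => dZ (u s) p.1 p.2) t)))
    (d := fun n t => ∫ p in bx 0 ((n:ℝ)+1), (1 - p.2/((n:ℝ)+1))^2 *
      ((dZ (dZ (u t)) p.1 p.2)^2 + (dX (u t) p.1 p.2)^2))
    (r := fun n t => κ * (2/((n:ℝ)+1)^2) *
      ∫ p in bx 0 ((n:ℝ)+1), ((dZ (u t) p.1 p.2)^2 + (dZ (b t) p.1 p.2)^2))
    (a := (4/κ) * M^2) (c := κ) (K := 8 * κ)
    (by positivity) hκ hE ?_ ?_ ?_ ?_ ?_ ?_ ?_ ?_ ?_ ?_ ?_ ?_ ?_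
  · intro n
    exact bx_cont (F := fun t p => (1 - p.2/((n:ℝ)+1))^2 * (dZ (u t) p.1 p.2)^2) (by fun_prop) _ _
  · intro n
    exact bx_cont (F := fun t p => (1 - p.2/((n:ℝ)+1))^2 *
      ((dZ (dZ (u t)) p.1 p.2)^2 + (dX (u t) p.1 p.2)^2)) (by fun_prop) _ _
  · intro n
    exact (bx_cont (F := fun t p => (dZ (u t) p.1 p.2)^2 + (dZ (b t) p.1 p.2)^2)
      (by fun_prop) _ _).const_mul _
  · refine (hE.continuousOn.const_mul (2*κ)).add (Continuous.continuousOn ?_)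
    refine Continuous.const_mul ?_ _
    exact continuous_parametric_integral_of_continuous (f := fun t x => (dZ (b t) x 0)^2)
      (by rw [Function.uncurry_def]; fun_prop) isCompact_Icc
  · intro n τ _
    refine bx_deriv (F := fun t p => (1 - p.2/((n:ℝ)+1))^2 * (dZ (u t) p.1 p.2)^2)
      (F' := fun t p => 2 * ((1 - p.2/((n:ℝ)+1))^2 *
      (dZ (u t) p.1 p.2 * deriv (fun s => dZ (u s) p.1 p.2) t))) (by fun_prop) (by fun_prop) ?_ _ _ _
    intro t p
    have h : HasDerivAt (fun s => dZ (u s) p.1 p.2) (deriv (fun s => dZ (u s) p.1 p.2) t) t :=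
      (hu.dZ.hasDerivAt_t t p.1 p.2).differentiableAt.hasDerivAt
    refine ((h.pow 2).const_mul ((1 - p.2/((n:ℝ)+1))^2)).congr_deriv ?_
    push_cast
    ring
  · intro n τ hτ
    exact fixed_time (wt := fun x z => deriv (fun s => dZ (u s) x z) τ) hκ (by positivity)
      (hu.slice τ) (hb.slice τ) (hu.dZ.dT.slice τ).cont hU (hup τ) (hbp τ) (hu0 τ) (hw0 τ)
      (hcon τ hτ) (heq τ hτ) hzU
  · intro n τ
    refine MeasureTheory.integral_nonneg fun p => ?_
    positivity
  · intro τ hτ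
    obtain ⟨_, i2, i3⟩ := hint τ hτ
    exact cutI_mono (g := fun p => (dZ (dZ (u τ)) p.1 p.2)^2 + (dX (u τ) p.1 p.2)^2)
      (fun p => by positivity) (i3.add i2)
  · intro τ hτ
    obtain ⟨_, i2, i3⟩ := hint τ hτ
    have h := cutI_tendsto (g := fun p => (dZ (dZ (u τ)) p.1 p.2)^2 + (dX (u τ) p.1 p.2)^2)
      (i3.add i2)
    rw [MeasureTheory.integral_add i3 i2] at h
    exact h
  · intro n τ hτ
    obtain ⟨i1, i2, _⟩ := hint τ hτ
    have h := r_bound (R := (n:ℝ)+1) hκ (by linarith [(Nat.cast_nonneg n : (0:ℝ) ≤ n)])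
      (hu.slice τ) (hb.slice τ) (hcon τ hτ) i1 i2
    have h0 : 0 ≤ 8 * κ * sqL2 (dZ (dZ (u τ))) :=
      mul_nonneg (by positivity) (MeasureTheory.integral_nonneg fun p => sq_nonneg _)
    rw [abs_of_nonneg]
    · refine h.trans ?_
      linarith
    · refine mul_nonneg (by positivity) (MeasureTheory.integral_nonneg fun p => ?_)
      positivity
  · intro τ hτ
    obtain ⟨i1, i2, _⟩ := hint τ hτ
    exact r_tendsto hκ (hu.slice τ) (hb.slice τ) (hcon τ hτ) i1 i2
  · intro τ hτ
    exact cutI_tendsto (hint τ hτ).1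
  · intro n τ hτ
    exact cutI_le (fun p => sq_nonneg _) (hint τ hτ).1 n

/-- the vorticity energy estimate for the linearized Prandtl/Shercliff
system: with `ω = ∂_z u` solving
`∂_t ω + U ∂_x ω + v U'' - κ ∂²_z ω = κ ∂_x ∂_z b`, `∂_z ω = 0` at `z = 0`,
one has `(1/2)(d/dt)‖ω‖² + (κ/2)(‖∂_z ω‖² + ‖∂_x u‖²) ≤ (2/κ)‖zU''‖²_∞ ‖ω‖²`. -/
theorem stmt_10 (T κ : ℝ) (hT : 0 < T) (hκ : 0 < κ)
    (u ω b v : ℝ → ℝ → ℝ → ℝ) (U : ℝ → ℝ) (M : ℝ)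
    (hu : ContDiff ℝ (⊤ : ℕ∞) (fun p : ℝ × ℝ × ℝ => u p.1 p.2.1 p.2.2))
    (hb : ContDiff ℝ (⊤ : ℕ∞) (fun p : ℝ × ℝ × ℝ => b p.1 p.2.1 p.2.2))
    (hU : ContDiff ℝ (⊤ : ℕ∞) U)
    (hup : ∀ t z, Function.Periodic (fun x => u t x z) 1)
    (hbp : ∀ t z, Function.Periodic (fun x => b t x z) 1)
    (hω : ∀ t x z, ω t x z = dZ (u t) x z)
    (hv : ∀ t x z, v t x z = -∫ s in (0:ℝ)..z, dX (u t) x s)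
    (hu0 : ∀ t x, u t x 0 = 0) (hb0 : ∀ t x, b t x 0 = 0)
    (hω'0 : ∀ t x, dZ (ω t) x 0 = 0)
    (hudec : ∀ t x, Tendsto (fun z => u t x z) atTop (𝓝 0))
    (hbdec : ∀ t x, Tendsto (fun z => b t x z) atTop (𝓝 0))
    (hωdec : ∀ t x, Tendsto (fun z => ω t x z) atTop (𝓝 0))
    (hω'dec : ∀ t x, Tendsto (fun z => dZ (ω t) x z) atTop (𝓝 0))
    (hb'dec : ∀ t x, Tendsto (fun z => dZ (b t) x z) atTop (𝓝 0))
    (heq : ∀ t ∈ Ioo 0 T, ∀ (x : ℝ), ∀ z ∈ Ioi (0:ℝ),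
        deriv (fun s => ω s x z) t + U z * dX (ω t) x z
          + v t x z * deriv (deriv U) z - κ * dZ (dZ (ω t)) x z
          = κ * dX (dZ (b t)) x z)
    (hconstraint : ∀ t ∈ Ioo 0 T, ∀ (x : ℝ), ∀ z ∈ Ioi (0:ℝ),
        dX (u t) x z + dZ (dZ (b t)) x z = 0)
    (hM : 0 ≤ M) (hzU'' : ∀ z ∈ Ici (0:ℝ), |z * deriv (deriv U) z| ≤ M)
    (hint : ∀ t ∈ Icc 0 T,
        Integrable (fun p : ℝ × ℝ => (ω t p.1 p.2)^2) μΩ ∧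
        Integrable (fun p : ℝ × ℝ => (dX (u t) p.1 p.2)^2) μΩ ∧
        Integrable (fun p : ℝ × ℝ => (dZ (ω t) p.1 p.2)^2) μΩ)
    (hEdiff : DifferentiableOn ℝ (fun s => sqL2 (ω s)) (Ioo 0 T)) :
    ∀ t ∈ Ioo 0 T,
      (1/2) * deriv (fun s => sqL2 (ω s)) t
        + (κ/2) * (sqL2 (dZ (ω t)) + sqL2 (dX (u t)))
        ≤ (2/κ) * M^2 * sqL2 (ω t) := by
  have hω' : ω = fun t => dZ (u t) := by
    funext t x z; exact hω t x z
  subst hω'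
  have hu' : Sm u := hu
  have hb' : Sm b := hb
  have hUd : Continuous (deriv (deriv U)) := by
    have h1 : ContDiff ℝ (⊤ : ℕ∞) (deriv U) := (contDiff_infty_iff_deriv.1 hU).2
    exact (contDiff_infty_iff_deriv.1 h1).2.continuous
  have hUc := hU.continuous
  have sl : ∀ {g : ℝ → ℝ → ℝ}, Sm2 g → ∀ x, Continuous fun z => g x z := fun hg x =>
    hg.cont.comp (by fun_prop : Continuous fun z : ℝ => (x, z))
  have hcon : ∀ t ∈ Ioo 0 T, ∀ x, ∀ z ∈ Ici (0:ℝ), dX (u t) x z + dZ (dZ (b t)) x z = 0 := by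
    intro t ht x
    exact ext_Ici (f := fun z => dX (u t) x z + dZ (dZ (b t)) x z) (g := fun _ => 0)
      ((sl (hu'.slice t).dX x).add (sl (hb'.slice t).dZ.dZ x)) continuous_const
      (hconstraint t ht x)
  have hveq : ∀ t ∈ Ioo 0 T, ∀ x, ∀ z ∈ Ici (0:ℝ), v t x z = dZ (b t) x z - dZ (b t) x 0 := by
    intro t ht x z hz
    rw [hv, ← intervalIntegral.integral_neg]
    refine intervalIntegral.integral_eq_sub_of_hasDerivAt (fun s hs => ?_)
      ((sl (hu'.slice t).dX x).neg.intervalIntegrable _ _)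
    rw [uIcc_of_le hz] at hs
    have h := (hb'.slice t).dZ.hZ x s
    have e : dZ (dZ (b t)) x s = - dX (u t) x s := by linarith [hcon t ht x s hs.1]
    rwa [e] at h
  have key := energy_aux T κ hκ u b U M hu' hb' hU hup hbp hu0 hω'0 hcon (by
    intro t ht x
    have c1 := sl (hu'.dZ.dT.slice t) x
    have c2 := sl (hu'.slice t).dZ.dX x
    have c3 := sl (hb'.slice t).dZ x
    have c4 := sl (hu'.slice t).dZ.dZ.dZ x
    have c5 := sl (hb'.slice t).dZ.dX x
    refine ext_Ici (f := fun z => deriv (fun s => dZ (u s) x z) t + U z * dX (dZ (u t)) x z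
          + (dZ (b t) x z - dZ (b t) x 0) * deriv (deriv U) z - κ * dZ (dZ (dZ (u t))) x z)
      (g := fun z => κ * dX (dZ (b t)) x z) (by fun_prop) (by fun_prop) ?_
    intro z hz
    have h := heq t ht x z hz
    rw [hveq t ht x z (Ioi_subset_Ici_self hz)] at h
    exact h) hzU'' (fun t ht => hint t ⟨ht.1.le, ht.2.le⟩) hEdiff
  intro t ht
  have h := key t ht
  have e : (2/κ) * M^2 * sqL2 (dZ (u t)) = (1/2) * ((4/κ) * M^2 * sqL2 (dZ (u t))) := by ring
  show (1/2) * deriv (fun s => sqL2 (dZ (u s))) t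
        + (κ/2) * (sqL2 (dZ (dZ (u t))) + sqL2 (dX (u t))) ≤ (2/κ) * M^2 * sqL2 (dZ (u t))
  rw [e]
  linarith
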